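/- Let xᵢ, x₁, x₂ be points of the Euclidean plane with pairwise distances at least 2, and suppose there exist y ∈ ℝ² and r < 2 with dist y xᵢ = dist y x₁ = dist y x₂ = r. Then the entire unit circle sector of xᵢ spanned by the directions to x₁ and x₂ lies inside the triangle: every point p of the form p = xᵢ + s•(x₁ − xᵢ) + t•(x₂ − xᵢ) with s ≥ 0, t ≥ 0 and dist xᵢ p ≤ 1 belongs to the convex hull of {xᵢ, x₁, x₂}. -/

import Mathlib

/-- Four times the squared area of a triangle with vertices `0`, `(a, b)`, `(c, d)`, multiplied by
the squared circumradius, is the product of the squared side lengths. The circumcenter is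
`(e, f)`. -/
lemma four_mul_sq_cross_mul_sq_circumradius {a b c d e f : ℝ}
    (hu : a ^ 2 + b ^ 2 = 2 * (e * a + f * b)) (hv : c ^ 2 + d ^ 2 = 2 * (e * c + f * d)) :
    4 * (a * d - b * c) ^ 2 * (e ^ 2 + f ^ 2) =
      (a ^ 2 + b ^ 2) * (c ^ 2 + d ^ 2) * ((a - c) ^ 2 + (b - d) ^ 2) := by
  have he : 2 * ((a * d - b * c) * e) = (a ^ 2 + b ^ 2) * d - (c ^ 2 + d ^ 2) * b := by
    rw [hu, hv]; ring
  have hf : 2 * ((a * d - b * c) * f) = (c ^ 2 + d ^ 2) * a - (a ^ 2 + b ^ 2) * c := by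
    rw [hu, hv]; ring
  calc 4 * (a * d - b * c) ^ 2 * (e ^ 2 + f ^ 2)
      = (2 * ((a * d - b * c) * e)) ^ 2 + (2 * ((a * d - b * c) * f)) ^ 2 := by ring
    _ = _ := by rw [he, hf]; ring

/-- If a triangle with vertex at the origin has sides of length at least `2` and circumradius less
than `2`, the part of the unit disk in the cone at the origin lies in the triangle. -/
lemma add_le_one_of_sq_circumradius_lt {a b c d e f s t : ℝ}
    (hu : a ^ 2 + b ^ 2 = 2 * (e * a + f * b)) (hv : c ^ 2 + d ^ 2 = 2 * (e * c + f * d))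
    (hA : 4 ≤ a ^ 2 + b ^ 2) (hB : 4 ≤ c ^ 2 + d ^ 2) (hC : 4 ≤ (a - c) ^ 2 + (b - d) ^ 2)
    (hr : e ^ 2 + f ^ 2 < 4)
    (hp : (s * a + t * c) ^ 2 + (s * b + t * d) ^ 2 ≤ 1) : s + t ≤ 1 := by
  have key := four_mul_sq_cross_mul_sq_circumradius hu hv
  set C := (a - c) ^ 2 + (b - d) ^ 2 with hCdef
  set D := a * d - b * c with hD
  have hAB : 16 ≤ (a ^ 2 + b ^ 2) * (c ^ 2 + d ^ 2) := by nlinarith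
  have hABC : 16 * C ≤ (a ^ 2 + b ^ 2) * (c ^ 2 + d ^ 2) * C := by gcongr
  have hDr : D ^ 2 * (e ^ 2 + f ^ 2) ≤ D ^ 2 * 4 := by gcongr
  have hCD : C ≤ D ^ 2 := by linarith
  have cauchy : (s + t) ^ 2 * D ^ 2 ≤ ((s * a + t * c) ^ 2 + (s * b + t * d) ^ 2) * C := by
    have : ((s * a + t * c) ^ 2 + (s * b + t * d) ^ 2) * C - (s + t) ^ 2 * D ^ 2 =
        ((s * a + t * c) * (a - c) + (s * b + t * d) * (b - d)) ^ 2 := by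
      rw [hCdef, hD]; ring
    linarith [sq_nonneg ((s * a + t * c) * (a - c) + (s * b + t * d) * (b - d))]
  have hpC : ((s * a + t * c) ^ 2 + (s * b + t * d) ^ 2) * C ≤ 1 * C := by gcongr
  have hst : (s + t) ^ 2 * C ≤ (s + t) ^ 2 * D ^ 2 := by gcongr
  have hst1 : (s + t) ^ 2 ≤ 1 := by
    refine le_of_mul_le_mul_right (a := C) ?_ (by linarith)
    linarith
  nlinarith

lemma EuclideanSpace.dist_sq_fin_two (x y : EuclideanSpace ℝ (Fin 2)) :
    dist x y ^ 2 = (x 0 - y 0) ^ 2 + (x 1 - y 1) ^ 2 := by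
  rw [EuclideanSpace.dist_eq, Real.sq_sqrt (by positivity), Fin.sum_univ_two]
  simp only [Real.dist_eq, sq_abs]

theorem L_triangle_contains_circle_sector
    (xi x₁ x₂ : EuclideanSpace ℝ (Fin 2))
    (h₁ : dist xi x₁ ≥ 2) (h₂ : dist xi x₂ ≥ 2) (h₁₂ : dist x₁ x₂ ≥ 2)
    (y : EuclideanSpace ℝ (Fin 2)) (r : ℝ) (hr : r < 2)
    (hy₀ : dist y xi = r) (hy₁ : dist y x₁ = r) (hy₂ : dist y x₂ = r) :
    ∀ (s t : ℝ), 0 ≤ s → 0 ≤ t →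
      ∀ p : EuclideanSpace ℝ (Fin 2),
        p = xi + s • (x₁ - xi) + t • (x₂ - xi) → dist xi p ≤ 1 →
        p ∈ convexHull ℝ {xi, x₁, x₂} := by
  intro s t hs ht p hp hd
  have hr0 : 0 ≤ r := hy₀ ▸ dist_nonneg
  have e₀ := EuclideanSpace.dist_sq_fin_two y xi
  have e₁ := EuclideanSpace.dist_sq_fin_two y x₁
  have e₂ := EuclideanSpace.dist_sq_fin_two y x₂
  rw [hy₀] at e₀
  rw [hy₁] at e₁
  rw [hy₂] at e₂
  have f₁ := EuclideanSpace.dist_sq_fin_two xi x₁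
  have f₂ := EuclideanSpace.dist_sq_fin_two xi x₂
  have f₁₂ := EuclideanSpace.dist_sq_fin_two x₁ x₂
  have fp := EuclideanSpace.dist_sq_fin_two xi p
  have g₁ : 4 ≤ dist xi x₁ ^ 2 := by nlinarith only [h₁]
  have g₂ : 4 ≤ dist xi x₂ ^ 2 := by nlinarith only [h₂]
  have g₁₂ : 4 ≤ dist x₁ x₂ ^ 2 := by nlinarith only [h₁₂]
  have gp : dist xi p ^ 2 ≤ 1 := pow_le_one₀ dist_nonneg hd
  have gr : r ^ 2 < 4 := by nlinarith only [hr, hr0]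
  have hp0 : p 0 = xi 0 + s * (x₁ 0 - xi 0) + t * (x₂ 0 - xi 0) := by simp [hp]
  have hp1 : p 1 = xi 1 + s * (x₁ 1 - xi 1) + t * (x₂ 1 - xi 1) := by simp [hp]
  rw [hp0, hp1] at fp
  have hst : s + t ≤ 1 :=
    add_le_one_of_sq_circumradius_lt (a := x₁ 0 - xi 0) (b := x₁ 1 - xi 1) (c := x₂ 0 - xi 0)
      (d := x₂ 1 - xi 1) (e := y 0 - xi 0) (f := y 1 - xi 1) (by linear_combination e₀ - e₁)
      (by linear_combination e₀ - e₂) (by linear_combination g₁ + f₁)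
      (by linear_combination g₂ + f₂) (by linear_combination g₁₂ + f₁₂)
      (by linear_combination gr - e₀) (by linear_combination gp - fp)
  rw [convexHull_insert (Set.insert_nonempty _ _), convexHull_pair, mem_convexJoin]
  rcases (add_nonneg hs ht).eq_or_lt with h0 | h0
  · obtain rfl : s = 0 := by linarith
    obtain rfl : t = 0 := by linarith
    exact ⟨xi, rfl, x₁, left_mem_segment ℝ _ _, by simpa [hp] using left_mem_segment ℝ xi x₁⟩
  · refine ⟨xi, rfl, (s / (s + t)) • x₁ + (t / (s + t)) • x₂,
      ⟨_, _, by positivity, by positivity, by field_simp, rfl⟩,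
      1 - (s + t), s + t, by linarith, h0.le, by ring, ?_⟩
    rw [smul_add, smul_smul, smul_smul, mul_div_cancel₀ _ h0.ne', mul_div_cancel₀ _ h0.ne', hp]
    module
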